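/- Let 0 < α < n, let Φ, Ψ be Orlicz functions, and let 0 ≤ λ, μ < 1. If the Riesz potential I_α is bounded from M^{Φ,λ}(0) to M^{Ψ,μ}(0), i.e., ‖I_α f‖_{M^{Ψ,μ}(0)} ≤ C ‖f‖_{M^{Φ,λ}(0)} for some C > 0 and all f ∈ M^{Φ,λ}(0), then there exists a constant C₁ > 0 such that u^{α/n} Φ⁻¹(u^{λ−1}) ≤ C₁ Ψ⁻¹(u^{μ−1}) for all u > 0. -/

import Mathlib

open MeasureTheory Metric Set Filter ENNReal NNReal Topology

noncomputable section

/-- ℝⁿ as Euclidean space. -/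
abbrev Eu (n : ℕ) : Type := EuclideanSpace ℝ (Fin n)

/-- The (right-continuous) generalized inverse `Φ⁻¹(v) = inf {u ≥ 0 : Φ(u) > v}`
(with `inf ∅ = ∞`). -/
def yInv (Φ : ℝ≥0∞ → ℝ≥0∞) (v : ℝ≥0∞) : ℝ≥0∞ := sInf {u : ℝ≥0∞ | v < Φ u}

/-- The complementary (conjugate) function `Φ*(v) = sup_{u > 0} (u⬝v − Φ(u))`. -/
def yConj (Φ : ℝ≥0∞ → ℝ≥0∞) (v : ℝ≥0∞) : ℝ≥0∞ :=
  ⨆ (u : ℝ≥0∞) (_ : 0 < u) (_ : u ≠ ∞), u * v - Φ u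

/-- The dilation function `s_{Φ⁻¹}(t) = sup_{s > 0} Φ⁻¹(st)/Φ⁻¹(s)`. -/
def sDil (Φ : ℝ≥0∞ → ℝ≥0∞) (t : ℝ≥0∞) : ℝ≥0∞ :=
  ⨆ (s : ℝ≥0∞) (_ : 0 < s) (_ : s ≠ ∞), yInv Φ (s * t) / yInv Φ s

/-- A Young function: nondecreasing, convex, `Φ(0) = 0 = lim_{u→0+} Φ(u)`, not identically
`0` nor `∞` on `(0,∞)`, and left continuous (values in `[0,∞]`, the value at `∞` being the
canonical/limit extension). -/
structure IsYoungFn (Φ : ℝ≥0∞ → ℝ≥0∞) : Prop where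
  mono : Monotone Φ
  map_zero : Φ 0 = 0
  tendsto_zero : Filter.Tendsto Φ (nhdsWithin 0 (Set.Ioi 0)) (nhds 0)
  convex : ∀ a b t : ℝ≥0∞, t ≤ 1 → Φ (t * a + (1 - t) * b) ≤ t * Φ a + (1 - t) * Φ b
  not_zero : ∃ u : ℝ≥0∞, 0 < u ∧ u ≠ ∞ ∧ Φ u ≠ 0
  not_top : ∃ u : ℝ≥0∞, 0 < u ∧ u ≠ ∞ ∧ Φ u ≠ ∞
  left_cont : ∀ u : ℝ≥0∞, 0 < u → Filter.Tendsto Φ (nhdsWithin u (Set.Iio u)) (nhds (Φ u))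

/-- An Orlicz function: increasing, continuous, convex, `Φ(0) = 0`, finite on `[0,∞)`
(the value at `∞` being the canonical extension `Φ(∞) = ∞`). -/
structure IsOrliczFn (Φ : ℝ≥0∞ → ℝ≥0∞) : Prop where
  map_zero : Φ 0 = 0
  strictMono : StrictMono Φ
  continuous : Continuous Φ
  convex : ∀ a b t : ℝ≥0∞, t ≤ 1 → Φ (t * a + (1 - t) * b) ≤ t * Φ a + (1 - t) * Φ b
  finite : ∀ u : ℝ≥0∞, u ≠ ∞ → Φ u ≠ ∞
  map_top : Φ ∞ = ∞

/-- The Δ₂-condition: `0 < Φ(u) < ∞` for `0 < u < ∞` and `Φ(2u) ≤ D₂ Φ(u)` for some `D₂ ≥ 1`. -/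
def IsDelta2 (Φ : ℝ≥0∞ → ℝ≥0∞) : Prop :=
  (∀ u : ℝ≥0∞, 0 < u → u ≠ ∞ → 0 < Φ u ∧ Φ u ≠ ∞) ∧
    ∃ D : ℝ≥0∞, 1 ≤ D ∧ D ≠ ∞ ∧ ∀ u : ℝ≥0∞, u ≠ ∞ → Φ (2 * u) ≤ D * Φ u

/-- The Luxemburg-type functional `‖f‖_{Φ,λ,A}`. -/
def orliczNorm {n : ℕ} (Φ : ℝ≥0∞ → ℝ≥0∞) (lam : ℝ) (A : Set (Eu n)) (f : Eu n → ℝ) : ℝ≥0∞ :=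
  sInf {ε : ℝ≥0∞ | 0 < ε ∧ ε ≠ ∞ ∧
    volume A ^ (-lam) * ∫⁻ x in A, Φ ((‖f x‖₊ : ℝ≥0∞) / ε) ≤ 1}

/-- The weak Luxemburg-type functional `‖f‖_{Φ,λ,A,∞}`. -/
def orliczWeakNorm {n : ℕ} (Φ : ℝ≥0∞ → ℝ≥0∞) (lam : ℝ) (A : Set (Eu n)) (f : Eu n → ℝ) : ℝ≥0∞ :=
  sInf {ε : ℝ≥0∞ | 0 < ε ∧ ε ≠ ∞ ∧
    (⨆ (u : ℝ≥0) (_ : 0 < u),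
      Φ ((u : ℝ≥0∞) / ε) * (volume A ^ (-lam) * volume {x ∈ A | u < ‖f x‖₊})) ≤ 1}

/-- The central Morrey–Orlicz norm `‖f‖_{M^{Φ,λ}(0)} = sup_{r>0} ‖f‖_{Φ,λ,B_r}`. -/
def centralNorm {n : ℕ} (Φ : ℝ≥0∞ → ℝ≥0∞) (lam : ℝ) (f : Eu n → ℝ) : ℝ≥0∞ :=
  ⨆ (r : ℝ) (_ : 0 < r), orliczNorm Φ lam (ball (0 : Eu n) r) f

/-- The weak central Morrey–Orlicz norm `‖f‖_{WM^{Φ,λ}(0)} = sup_{r>0} ‖f‖_{Φ,λ,B_r,∞}`. -/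
def centralWeakNorm {n : ℕ} (Φ : ℝ≥0∞ → ℝ≥0∞) (lam : ℝ) (f : Eu n → ℝ) : ℝ≥0∞ :=
  ⨆ (r : ℝ) (_ : 0 < r), orliczWeakNorm Φ lam (ball (0 : Eu n) r) f

/-- The Riesz potential `I_α f(x) = ∫ f(y) |x−y|^{α−n} dy`. -/
def riesz {n : ℕ} (α : ℝ) (f : Eu n → ℝ) (x : Eu n) : ℝ :=
  ∫ y, f y / ‖x - y‖ ^ ((n : ℝ) - α)

/-- The classical Morrey norm `‖f‖_{M^{p,λ}}`. -/
def morreyNormP {n : ℕ} (p lam : ℝ) (f : Eu n → ℝ) : ℝ≥0∞ :=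
  ⨆ (x₀ : Eu n) (r : ℝ) (_ : 0 < r),
    (volume (ball x₀ r) ^ (-lam) * ∫⁻ x in ball x₀ r, (‖f x‖₊ : ℝ≥0∞) ^ p) ^ (1 / p)

/-- The classical central Morrey norm `‖f‖_{M^{p,λ}(0)}`. -/
def centralNormP {n : ℕ} (p lam : ℝ) (f : Eu n → ℝ) : ℝ≥0∞ :=
  ⨆ (r : ℝ) (_ : 0 < r),
    (volume (ball (0 : Eu n) r) ^ (-lam) * ∫⁻ x in ball (0 : Eu n) r, (‖f x‖₊ : ℝ≥0∞) ^ p) ^ (1 / p)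

theorem IsOrliczFn.apply_yInv {Φ : ℝ≥0∞ → ℝ≥0∞} (hΦ : IsOrliczFn Φ) {v : ℝ≥0∞}
    (hv : v ≠ 0) (hv' : v ≠ ∞) : yInv Φ v ≠ 0 ∧ yInv Φ v ≠ ∞ ∧ Φ (yInv Φ v) = v := by
  obtain ⟨a, -, ha⟩ : v ∈ Φ '' Icc 0 ∞ := by
    refine intermediate_value_Icc zero_le hΦ.continuous.continuousOn ?_
    simp [hΦ.map_zero, hΦ.map_top]
  have ha' : a ≠ ∞ := by rintro rfl; exact hv' (ha ▸ hΦ.map_top)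
  have h : yInv Φ v = a := by
    have hset : {u : ℝ≥0∞ | v < Φ u} = Ioi a := by
      ext u
      simp [← ha, hΦ.strictMono.lt_iff_lt]
    have : (Ioi a).Nonempty := ⟨∞, ha'.lt_top⟩
    rw [yInv, hset]
    exact (isGLB_Ioi.csInf_eq this)
  refine h ▸ ⟨?_, ha', ha⟩
  rintro rfl
  exact hv (ha ▸ hΦ.map_zero)

theorem centralNorm_indicator_ball_le {n : ℕ} {Φ : ℝ≥0∞ → ℝ≥0∞} (hΦ : IsOrliczFn Φ) {lam : ℝ}
    (hlam0 : 0 ≤ lam) (hlam1 : lam < 1) {R : ℝ} (hR : 0 < R) :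
    centralNorm Φ lam ((ball (0 : Eu n) R).indicator 1) ≤
      (yInv Φ (volume (ball (0 : Eu n) R) ^ (lam - 1)))⁻¹ := by
  have hpos : ∀ {r : ℝ}, 0 < r → volume (ball (0 : Eu n) r) ≠ 0 := fun hr =>
    (measure_ball_pos volume _ hr).ne'
  have hfin : ∀ {r : ℝ}, volume (ball (0 : Eu n) r) ≠ ∞ := measure_ball_lt_top.ne
  set U := volume (ball (0 : Eu n) R) with hU
  have hv : U ^ (lam - 1) ≠ 0 := by simp [ENNReal.rpow_eq_zero_iff, hpos hR, hfin, hU]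
  have hv' : U ^ (lam - 1) ≠ ∞ := by simp [ENNReal.rpow_eq_top_iff, hpos hR, hfin, hU]
  obtain ⟨h0, ht, hval⟩ := hΦ.apply_yInv hv hv'
  refine iSup₂_le fun r hr => sInf_le ⟨by simpa using ht, by simpa using h0, ?_⟩
  have hint : ∀ x : Eu n,
      Φ ((‖(ball (0 : Eu n) R).indicator (1 : Eu n → ℝ) x‖₊ : ℝ≥0∞) / (yInv Φ (U ^ (lam - 1)))⁻¹)
        = (ball (0 : Eu n) R).indicator (fun _ => U ^ (lam - 1)) x := by
    intro x
    by_cases hx : x ∈ ball (0 : Eu n) R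
    · simp [indicator_of_mem hx, hval]
    · simp [indicator_of_notMem hx, hΦ.map_zero]
  simp_rw [hint]
  rw [lintegral_indicator measurableSet_ball, lintegral_const, Measure.restrict_restrict
    measurableSet_ball, Measure.restrict_apply_univ]
  have hinter : ball (0 : Eu n) R ∩ ball 0 r = ball 0 (min R r) := by
    ext x; simp
  rw [hinter]
  set m := volume (ball (0 : Eu n) (min R r))
  have hm0 : m ≠ 0 := hpos (lt_min hR hr)
  have hmt : m ≠ ∞ := hfin
  have hmU : m ≤ U := measure_mono (ball_subset_ball (min_le_left _ _))
  have hmr : m ≤ volume (ball (0 : Eu n) r) := measure_mono (ball_subset_ball (min_le_right _ _))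
  calc volume (ball (0 : Eu n) r) ^ (-lam) * (U ^ (lam - 1) * m)
      ≤ m ^ (-lam) * (U ^ (lam - 1) * m) := by
        rw [ENNReal.rpow_neg, ENNReal.rpow_neg]
        gcongr
    _ = m ^ (1 - lam) * U ^ (lam - 1) := by
        rw [show (1 - lam) = -lam + 1 by ring, ENNReal.rpow_add _ _ hm0 hmt, ENNReal.rpow_one]
        ring
    _ ≤ U ^ (1 - lam) * U ^ (lam - 1) := by
        gcongr
    _ = 1 := by
        rw [← ENNReal.rpow_add _ _ (hpos hR) hfin]
        simp

theorem div_yInv_le_orliczNorm {n : ℕ} {Ψ : ℝ≥0∞ → ℝ≥0∞} (hΨ : IsOrliczFn Ψ) {mu : ℝ}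
    {R w : ℝ} (hR : 0 < R) {g : Eu n → ℝ} (hg : ∀ x ∈ ball (0 : Eu n) R, w ≤ g x) :
    ENNReal.ofReal w / yInv Ψ (volume (ball (0 : Eu n) R) ^ (mu - 1)) ≤
      orliczNorm Ψ mu (ball (0 : Eu n) R) g := by
  set U := volume (ball (0 : Eu n) R) with hU
  have hU0 : U ≠ 0 := (measure_ball_pos volume _ hR).ne'
  have hUt : U ≠ ∞ := measure_ball_lt_top.ne
  have hv : U ^ (mu - 1) ≠ 0 := by simp [ENNReal.rpow_eq_zero_iff, hU0, hUt]
  have hv' : U ^ (mu - 1) ≠ ∞ := by simp [ENNReal.rpow_eq_top_iff, hU0, hUt]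
  obtain ⟨h0, ht, hval⟩ := hΨ.apply_yInv hv hv'
  refine le_sInf fun ε ⟨hε0, hεt, hε⟩ => ?_
  have hlow : Ψ (ENNReal.ofReal w / ε) * U ≤ ∫⁻ x in ball (0 : Eu n) R, Ψ ((‖g x‖₊ : ℝ≥0∞) / ε) := by
    rw [hU, ← Measure.restrict_apply_univ (μ := volume) (ball (0 : Eu n) R), ← lintegral_const]
    refine setLIntegral_mono' measurableSet_ball fun x hx => hΨ.strictMono.monotone ?_
    gcongr
    rw [← enorm_eq_nnnorm, Real.enorm_eq_ofReal_abs]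
    exact ENNReal.ofReal_le_ofReal ((hg x hx).trans (le_abs_self _))
  have hle : Ψ (ENNReal.ofReal w / ε) ≤ Ψ (yInv Ψ (U ^ (mu - 1))) := by
    rw [hval]
    calc Ψ (ENNReal.ofReal w / ε)
        = U ^ (mu - 1) * (U ^ (-mu) * (Ψ (ENNReal.ofReal w / ε) * U)) := by
          have : U ^ (mu - 1) * (U ^ (-mu) * U ^ (1 : ℝ)) = 1 := by
            rw [← ENNReal.rpow_add _ _ hU0 hUt, ← ENNReal.rpow_add _ _ hU0 hUt]
            simp
          rw [ENNReal.rpow_one] at this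
          calc _ = Ψ (ENNReal.ofReal w / ε) * (U ^ (mu - 1) * (U ^ (-mu) * U)) := by
                rw [this, mul_one]
            _ = _ := by ring
      _ ≤ U ^ (mu - 1) * 1 := by
          gcongr
          exact le_trans (by gcongr) hε
      _ = _ := mul_one _
  have := hΨ.strictMono.le_iff_le.1 hle
  rw [ENNReal.div_le_iff hε0.ne' hεt] at this
  rwa [ENNReal.div_le_iff h0 ht, mul_comm]

theorem integrableOn_ball_norm_rpow {n : ℕ} {α : ℝ} (hα : 0 < α) (hαn : α < n) {R : ℝ} (hR : 0 < R) :
    IntegrableOn (fun y : Eu n => (‖y‖ ^ ((n : ℝ) - α))⁻¹) (ball 0 R) := by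
  have hn : 0 < n := by exact_mod_cast hα.trans hαn
  have : Nonempty (Fin n) := ⟨⟨0, hn⟩⟩
  rw [← integrable_indicator_iff measurableSet_ball]
  have h : ((ball (0 : Eu n) R).indicator fun y : Eu n => (‖y‖ ^ ((n : ℝ) - α))⁻¹) =
      fun y : Eu n => (Iio R).indicator (fun t : ℝ => (t ^ ((n : ℝ) - α))⁻¹) ‖y‖ := by
    ext y
    by_cases hy : ‖y‖ < R <;> simp [indicator, hy]
  rw [h, integrable_fun_norm_addHaar]
  have h2 : IntegrableOn (fun t : ℝ => t ^ (α - 1)) (Ioo 0 R) :=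
    (intervalIntegral.integrableOn_Ioo_rpow_iff hR).2 (by linarith)
  have h3 : IntegrableOn (fun t : ℝ => t ^ (n - 1) • (t ^ ((n : ℝ) - α))⁻¹) (Ioo 0 R) := by
    refine h2.congr_fun (fun t ht => ?_) measurableSet_Ioo
    simp only [smul_eq_mul]
    rw [← Real.rpow_natCast, ← Real.rpow_neg ht.1.le, ← Real.rpow_add ht.1,
      Nat.cast_sub (by lia)]
    congr 1
    push_cast
    ring
  have h4 := (integrable_indicator_iff measurableSet_Ioo).2 h3
  refine h4.integrableOn.congr_fun (fun t ht => ?_) measurableSet_Ioi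
  have ht' : 0 < t := ht
  by_cases htR : t < R <;> simp [indicator, htR, ht']

theorem le_riesz_indicator_ball {n : ℕ} {α : ℝ} (hα : 0 < α) (hαn : α < n) {R : ℝ}
    {x : Eu n} (hx : x ∈ ball (0 : Eu n) R) :
    volume.real (ball (0 : Eu n) R) / (2 * R) ^ ((n : ℝ) - α) ≤
      riesz α ((ball (0 : Eu n) R).indicator 1) x := by
  have hn : 0 < n := by exact_mod_cast hα.trans hαn
  have : Nonempty (Fin n) := ⟨⟨0, hn⟩⟩
  have hxR : ‖x‖ < R := by simpa using hx
  have hsub : ∀ y ∈ ball (0 : Eu n) R, ‖x - y‖ < 2 * R := by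
    intro y hy
    have : ‖y‖ < R := by simpa using hy
    linarith [norm_sub_le x y]
  have heq : (fun y : Eu n => (ball (0 : Eu n) R).indicator (1 : Eu n → ℝ) y /
      ‖x - y‖ ^ ((n : ℝ) - α)) =
      (ball (0 : Eu n) R).indicator fun y => (‖x - y‖ ^ ((n : ℝ) - α))⁻¹ := by
    ext y
    by_cases hy : y ∈ ball (0 : Eu n) R <;> simp [indicator, hy]
  have hint : IntegrableOn (fun y : Eu n => (‖x - y‖ ^ ((n : ℝ) - α))⁻¹) (ball 0 R) := by
    have h := (integrable_indicator_iff measurableSet_ball).2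
      (integrableOn_ball_norm_rpow hα hαn (by linarith [norm_nonneg x] : 0 < 2 * R))
    have h' := (h.comp_sub_left x).integrableOn (s := ball (0 : Eu n) R)
    refine h'.congr_fun (fun y hy => ?_) measurableSet_ball
    exact indicator_of_mem (by simpa using hsub y hy) _
  rw [riesz, heq, integral_indicator measurableSet_ball, div_eq_mul_inv, ← smul_eq_mul,
    ← setIntegral_const]
  refine setIntegral_mono_on_ae (integrableOn_const measure_ball_lt_top.ne) hint measurableSet_ball ?_
  filter_upwards [compl_mem_ae_iff.2 (measure_singleton x)] with y hy hyR
  have hne : 0 < ‖x - y‖ := norm_pos_iff.2 (sub_ne_zero.2 fun h => hy h.symm)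
  gcongr
  exact (hsub y hyR).le

theorem exists_volume_ball_eq {n : ℕ} (hn : n ≠ 0) {u : ℝ} (hu : 0 < u) :
    ∃ R : ℝ, 0 < R ∧ volume (ball (0 : Eu n) R) = ENNReal.ofReal u ∧
      R ^ n * volume.real (ball (0 : Eu n) 1) = u := by
  have hω : 0 < volume.real (ball (0 : Eu n) 1) :=
    ENNReal.toReal_pos (measure_ball_pos volume _ one_pos).ne' measure_ball_lt_top.ne
  have : Nonempty (Fin n) := ⟨⟨0, Nat.pos_of_ne_zero hn⟩⟩
  have hpow : ((u / volume.real (ball (0 : Eu n) 1)) ^ (n⁻¹ : ℝ)) ^ n *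
      volume.real (ball (0 : Eu n) 1) = u := by
    rw [Real.rpow_inv_natCast_pow (by positivity) hn, div_mul_cancel₀ _ hω.ne']
  refine ⟨_, by positivity, ?_, hpow⟩
  rw [Measure.addHaar_ball _ _ (by positivity), finrank_euclideanSpace_fin,
    ← ofReal_measureReal measure_ball_lt_top.ne, ← ENNReal.ofReal_mul (by positivity), hpow]

/-- necessary condition (a) for boundedness of the Riesz potential. -/
theorem statement7 {n : ℕ} (α : ℝ) (hα : 0 < α) (hαn : α < n)
    (Φ Ψ : ℝ≥0∞ → ℝ≥0∞) (hΦ : IsOrliczFn Φ) (hΨ : IsOrliczFn Ψ) (lam mu : ℝ)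
    (hlam0 : 0 ≤ lam) (hlam1 : lam < 1) (hmu0 : 0 ≤ mu) (hmu1 : mu < 1)
    (C : ℝ) (hC : 0 < C)
    (hbdd : ∀ f : Eu n → ℝ, LocallyIntegrable f volume → centralNorm Φ lam f ≠ ∞ →
      centralNorm Ψ mu (riesz α f) ≤ ENNReal.ofReal C * centralNorm Φ lam f) :
    ∃ C₁ : ℝ, 0 < C₁ ∧ ∀ u : ℝ, 0 < u →
      ENNReal.ofReal (u ^ (α / n)) * yInv Φ (ENNReal.ofReal (u ^ (lam - 1))) ≤
        ENNReal.ofReal C₁ * yInv Ψ (ENNReal.ofReal (u ^ (mu - 1))) := by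
  have hn0 : (0 : ℝ) < n := hα.trans hαn
  have hn : n ≠ 0 := by rintro rfl; simp at hn0
  set ω := volume.real (ball (0 : Eu n) 1)
  have hω : 0 < ω :=
    ENNReal.toReal_pos (measure_ball_pos volume _ one_pos).ne' measure_ball_lt_top.ne
  set D : ℝ := (2 ^ n / ω) ^ (1 - α / n) with hDdef
  have hD : 0 < D := by positivity
  refine ⟨C * D, by positivity, fun u hu => ?_⟩
  obtain ⟨R, hR, hvol, hRu⟩ := exists_volume_ball_eq hn hu
  have hw : u / (2 * R) ^ ((n : ℝ) - α) = u ^ (α / n) / D := by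
    have h1 : (2 * R) ^ ((n : ℝ) - α) = D * u ^ (1 - α / n) := by
      rw [hDdef, ← Real.mul_rpow (by positivity) hu.le, ← hRu,
        show 2 ^ n / ω * (R ^ n * ω) = (2 * R) ^ n by rw [mul_pow]; field_simp, ← Real.rpow_natCast,
        ← Real.rpow_mul (by positivity)]
      congr 1
      field_simp
    have h2 : u = u ^ (α / n) * u ^ (1 - α / n) := by
      rw [← Real.rpow_add hu]; simp
    rw [h1, div_eq_div_iff (by positivity) hD.ne']
    nth_rewrite 1 [h2]
    ring
  have hΦnorm := centralNorm_indicator_ball_le (n := n) hΦ hlam0 hlam1 hR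
  have hΨnorm := div_yInv_le_orliczNorm (n := n) (mu := mu) (w := u ^ (α / n) / D) hΨ hR
    (g := riesz α ((ball (0 : Eu n) R).indicator 1)) (fun x hx => by
      rw [← hw]
      simpa [Measure.real, hvol, hu.le] using le_riesz_indicator_ball hα hαn hx)
  rw [hvol, ENNReal.ofReal_rpow_of_pos hu] at hΦnorm hΨnorm
  obtain ⟨ha0, hat, -⟩ := hΦ.apply_yInv (v := ENNReal.ofReal (u ^ (lam - 1)))
    (by simpa using Real.rpow_pos_of_pos hu _) ENNReal.ofReal_ne_top
  obtain ⟨hb0, hbt, -⟩ := hΨ.apply_yInv (v := ENNReal.ofReal (u ^ (mu - 1)))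
    (by simpa using Real.rpow_pos_of_pos hu _) ENNReal.ofReal_ne_top
  have hloc : LocallyIntegrable ((ball (0 : Eu n) R).indicator (1 : Eu n → ℝ)) :=
    ((integrable_indicator_iff measurableSet_ball).2
      (integrableOn_const measure_ball_lt_top.ne)).locallyIntegrable
  have hbound := hbdd _ hloc (ne_top_of_le_ne_top (by simpa using ha0) hΦnorm)
  set a := yInv Φ (ENNReal.ofReal (u ^ (lam - 1)))
  set b := yInv Ψ (ENNReal.ofReal (u ^ (mu - 1)))
  have key : ENNReal.ofReal (u ^ (α / n) / D) / b ≤ ENNReal.ofReal C / a :=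
    calc ENNReal.ofReal (u ^ (α / n) / D) / b
        ≤ centralNorm Ψ mu (riesz α ((ball (0 : Eu n) R).indicator 1)) :=
          hΨnorm.trans (le_iSup₂ (f := fun (r : ℝ) (_ : 0 < r) =>
            orliczNorm Ψ mu (ball (0 : Eu n) r) (riesz α ((ball (0 : Eu n) R).indicator 1))) R hR)
      _ ≤ ENNReal.ofReal C * a⁻¹ := hbound.trans (by gcongr)
  rw [ENNReal.div_le_iff hb0 hbt, ← ENNReal.mul_div_right_comm, ENNReal.le_div_iff_mul_le
    (.inl ha0) (.inl hat)] at key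
  calc ENNReal.ofReal (u ^ (α / n)) * a
      = ENNReal.ofReal D * (ENNReal.ofReal (u ^ (α / n) / D) * a) := by
        rw [← mul_assoc, ← ENNReal.ofReal_mul hD.le, mul_div_cancel₀ _ hD.ne']
    _ ≤ ENNReal.ofReal D * (ENNReal.ofReal C * b) := by gcongr
    _ = ENNReal.ofReal (C * D) * b := by
        rw [ENNReal.ofReal_mul hC.le]; ring
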